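/- arXiv:2406.03945 — 4 statements merged into one kernel-verified Lean document; each statement's English description precedes it below -/
import Mathlib

section
/- Let θ ∈ (0, π/4], p ∈ [0,1], and let ρ_MM(θ,p) = p φ⁺(θ) + (1−p) ρ_A(θ)⊗ρ_B(θ) be the partially entangled state with symmetric coloured noise. Then both quantum steering ellipsoid centres satisfy ‖c_A(ρ_MM(θ,p))‖ = ‖c_B(ρ_MM(θ,p))‖ = (1−p)cos(2θ). -/
open Matrix Kronecker Complex
open scoped ComplexOrder

noncomputable section

/-- 2×2 complex matrices (one qubit operators). -/
abbrev Mat2 := Matrix (Fin 2) (Fin 2) ℂ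
/-- 4×4 complex matrices, indexed by ℂ²⊗ℂ² product indices (two qubit operators). -/
abbrev Mat4 := Matrix (Fin 2 × Fin 2) (Fin 2 × Fin 2) ℂ

/-- A two-qubit state: positive semidefinite with trace 1. -/
def IsState (ρ : Mat4) : Prop := ρ.PosSemidef ∧ ρ.trace = 1

/-- The Pauli matrices σ₁, σ₂, σ₃ (indexed by 0,1,2). -/
def pauli : Fin 3 → Mat2 :=
  ![!![0, 1; 1, 0], !![0, -Complex.I; Complex.I, 0], !![1, 0; 0, -1]]

/-- Alice's Bloch vector: a_i = tr((σ_i ⊗ 𝟙)ρ). -/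
def aVec (ρ : Mat4) : Fin 3 → ℝ := fun i => ((pauli i ⊗ₖ (1 : Mat2)) * ρ).trace.re
/-- Bob's Bloch vector: b_i = tr((𝟙 ⊗ σ_i)ρ). -/
def bVec (ρ : Mat4) : Fin 3 → ℝ := fun i => (((1 : Mat2) ⊗ₖ pauli i) * ρ).trace.re
/-- Correlation matrix: T_{ij} = tr((σ_i ⊗ σ_j)ρ). -/
def Tmat (ρ : Mat4) : Matrix (Fin 3) (Fin 3) ℝ :=
  Matrix.of fun i j => ((pauli i ⊗ₖ pauli j) * ρ).trace.re

/-- Euclidean norm on ℝ³. -/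
def norm3 (v : Fin 3 → ℝ) : ℝ := Real.sqrt (∑ i, v i ^ 2)

/-- Alice's quantum steering ellipsoid centre c_A = γ_b²(a − T b), γ_b² = 1/(1 − ‖b‖²). -/
def cA (ρ : Mat4) : Fin 3 → ℝ :=
  (1 - norm3 (bVec ρ) ^ 2)⁻¹ • (aVec ρ - Tmat ρ *ᵥ bVec ρ)
/-- Bob's quantum steering ellipsoid centre c_B = γ_a²(b − Tᵀ a), γ_a² = 1/(1 − ‖a‖²). -/
def cB (ρ : Mat4) : Fin 3 → ℝ :=
  (1 - norm3 (aVec ρ) ^ 2)⁻¹ • (bVec ρ - (Tmat ρ)ᵀ *ᵥ aVec ρ)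

/-- Alice's QSE matrix Q_A = γ_b²(T − a bᵀ)(𝟙₃ + γ_b² b bᵀ)(Tᵀ − b aᵀ). -/
def QA (ρ : Mat4) : Matrix (Fin 3) (Fin 3) ℝ :=
  (1 - norm3 (bVec ρ) ^ 2)⁻¹ •
    ((Tmat ρ - vecMulVec (aVec ρ) (bVec ρ)) *
      (1 + (1 - norm3 (bVec ρ) ^ 2)⁻¹ • vecMulVec (bVec ρ) (bVec ρ)) *
      ((Tmat ρ)ᵀ - vecMulVec (bVec ρ) (aVec ρ)))

/-- Bob's QSE matrix Q_B = γ_a²(Tᵀ − b aᵀ)(𝟙₃ + γ_a² a aᵀ)(T − a bᵀ). -/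
def QB (ρ : Mat4) : Matrix (Fin 3) (Fin 3) ℝ :=
  (1 - norm3 (aVec ρ) ^ 2)⁻¹ •
    (((Tmat ρ)ᵀ - vecMulVec (bVec ρ) (aVec ρ)) *
      (1 + (1 - norm3 (aVec ρ) ^ 2)⁻¹ • vecMulVec (aVec ρ) (aVec ρ)) *
      (Tmat ρ - vecMulVec (aVec ρ) (bVec ρ)))

/-- The Alice-filtered state ρ'_FA = (f⊗𝟙)ρ(f⊗𝟙)† / tr[(f†f⊗𝟙)ρ]. -/
def filterA (ρ : Mat4) (f : Mat2) : Mat4 :=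
  ((((fᴴ * f) ⊗ₖ (1 : Mat2)) * ρ).trace)⁻¹ • ((f ⊗ₖ (1 : Mat2)) * ρ * (f ⊗ₖ (1 : Mat2))ᴴ)

/-- The Bob-filtered state ρ'_FB = (𝟙⊗f)ρ(𝟙⊗f)† / tr[(𝟙⊗f†f)ρ]. -/
def filterB (ρ : Mat4) (f : Mat2) : Mat4 :=
  ((((1 : Mat2) ⊗ₖ (fᴴ * f)) * ρ).trace)⁻¹ • (((1 : Mat2) ⊗ₖ f) * ρ * ((1 : Mat2) ⊗ₖ f)ᴴ)

/-- The two-sided filtered state (f_A⊗f_B)ρ(f_A⊗f_B)† / tr[(f_A†f_A ⊗ f_B†f_B)ρ]. -/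
def filterAB (ρ : Mat4) (f g : Mat2) : Mat4 :=
  ((((fᴴ * f) ⊗ₖ (gᴴ * g)) * ρ).trace)⁻¹ • ((f ⊗ₖ g) * ρ * (f ⊗ₖ g)ᴴ)

/-- The qubit observable α·σ for α ∈ ℝ³. -/
def obs (α : Fin 3 → ℝ) : Mat2 := ∑ k, (α k : ℂ) • pauli k

/-- The expectation value ⟨A⊗B⟩_ρ = tr((A⊗B)ρ) (real for states/Hermitian observables). -/
def expVal (ρ : Mat4) (A B : Mat2) : ℝ := ((A ⊗ₖ B) * ρ).trace.re

/-- The CHSH functional ½(⟨A¹B¹⟩+⟨A¹B²⟩+⟨A²B¹⟩−⟨A²B²⟩). -/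
def chshVal (ρ : Mat4) (α1 α2 β1 β2 : Fin 3 → ℝ) : ℝ :=
  (expVal ρ (obs α1) (obs β1) + expVal ρ (obs α1) (obs β2)
    + expVal ρ (obs α2) (obs β1) - expVal ρ (obs α2) (obs β2)) / 2

/-- The maximal CHSH value B(ρ) over measurement directions (unit vectors in ℝ³). -/
def Bval (ρ : Mat4) : ℝ :=
  sSup {x | ∃ α1 α2 β1 β2 : Fin 3 → ℝ, norm3 α1 = 1 ∧ norm3 α2 = 1 ∧
    norm3 β1 = 1 ∧ norm3 β2 = 1 ∧ x = chshVal ρ α1 α2 β1 β2}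

/-- The F₃ functional (1/√3)Σᵢ tr((Aⁱ⊗σᵢ)ρ). -/
def f3Val (ρ : Mat4) (α : Fin 3 → Fin 3 → ℝ) : ℝ :=
  (∑ i, expVal ρ (obs (α i)) (pauli i)) / Real.sqrt 3

/-- The maximal F₃ value over measurement directions. -/
def F3val (ρ : Mat4) : ℝ :=
  sSup {x | ∃ α : Fin 3 → Fin 3 → ℝ, (∀ i, norm3 (α i) = 1) ∧ x = f3Val ρ α}

/-- Partial trace over Bob (second factor). -/
def trB (M : Mat4) : Mat2 := Matrix.of fun i j => ∑ k, M (i, k) (j, k)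
/-- Partial trace over Alice (first factor). -/
def trA (M : Mat4) : Mat2 := Matrix.of fun i j => ∑ k, M (k, i) (k, j)

/-- The vector |φ⁺(θ)⟩ = cosθ|00⟩ + sinθ|11⟩. -/
def phiVec (θ : ℝ) : Fin 2 × Fin 2 → ℂ :=
  fun q => if q = (0, 0) then (Real.cos θ : ℂ) else if q = (1, 1) then (Real.sin θ : ℂ) else 0

/-- The projector φ⁺(θ) = |φ⁺(θ)⟩⟨φ⁺(θ)|. -/
def phiProj (θ : ℝ) : Mat4 := vecMulVec (phiVec θ) (star (phiVec θ))

/-- ρ_A(θ) = tr_B φ⁺(θ) = diag(cos²θ, sin²θ). -/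
def rhoA (θ : ℝ) : Mat2 := !![(Real.cos θ : ℂ) ^ 2, 0; 0, (Real.sin θ : ℂ) ^ 2]

/-- Partially entangled state with one-sided coloured noise. -/
def rhoM (θ p : ℝ) : Mat4 :=
  (p : ℂ) • phiProj θ + ((1 - p : ℝ) : ℂ) • (rhoA θ ⊗ₖ ((1 / 2 : ℂ) • (1 : Mat2)))

/-- Partially entangled state with symmetric coloured noise. -/
def rhoMM (θ p : ℝ) : Mat4 :=
  (p : ℂ) • phiProj θ + ((1 - p : ℝ) : ℂ) • (rhoA θ ⊗ₖ rhoA θ)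

/-- The vector |Φ⁺⟩ = (|00⟩+|11⟩)/√2. -/
def maxEntVec : Fin 2 × Fin 2 → ℂ :=
  fun q => if q.1 = q.2 then ((Real.sqrt 2 : ℂ))⁻¹ else 0

/-- The projector Φ⁺ = |Φ⁺⟩⟨Φ⁺|. -/
def maxEntProj : Mat4 := vecMulVec maxEntVec (star maxEntVec)

/-- The singlet vector |Ψ⁻⟩ = (|01⟩−|10⟩)/√2. -/
def singletVec : Fin 2 × Fin 2 → ℂ :=
  fun q => if q = (0, 1) then ((Real.sqrt 2 : ℂ))⁻¹
    else if q = (1, 0) then -((Real.sqrt 2 : ℂ))⁻¹ else 0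

/-- The singlet projector |Ψ⁻⟩⟨Ψ⁻|. -/
def singletProj : Mat4 := vecMulVec singletVec (star singletVec)

/-- The vector |00⟩. -/
def zeroVec : Fin 2 × Fin 2 → ℂ := fun q => if q = (0, 0) then 1 else 0

/-- The quasi-distillable state ρ_QD(p) = p|Ψ⁻⟩⟨Ψ⁻| + (1−p)|00⟩⟨00|. -/
def rhoQD (p : ℝ) : Mat4 :=
  (p : ℂ) • singletProj + ((1 - p : ℝ) : ℂ) • vecMulVec zeroVec (star zeroVec)

theorem aVec_rhoMM (θ p : ℝ) : aVec (rhoMM θ p) = ![0, 0, Real.cos (2 * θ)] := by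
  funext i
  fin_cases i <;>
    simp [aVec, rhoMM, pauli, rhoA, phiProj, phiVec, Matrix.trace, Matrix.mul_apply,
      Fintype.sum_prod_type, Fin.sum_univ_two, vecMulVec_apply, kroneckerMap_apply,
      -Complex.ofReal_cos, -Complex.ofReal_sin, ← Complex.ofReal_pow, ← Complex.ofReal_mul]
  rw [Real.cos_two_mul, Real.sin_sq]
  ring_nf
  rw [Real.sin_sq]
  ring

theorem bVec_rhoMM (θ p : ℝ) : bVec (rhoMM θ p) = ![0, 0, Real.cos (2 * θ)] := by
  funext i
  fin_cases i <;>
    simp [bVec, rhoMM, pauli, rhoA, phiProj, phiVec, Matrix.trace, Matrix.mul_apply,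
      Fintype.sum_prod_type, Fin.sum_univ_two, vecMulVec_apply, kroneckerMap_apply,
      -Complex.ofReal_cos, -Complex.ofReal_sin, ← Complex.ofReal_pow, ← Complex.ofReal_mul]
  rw [Real.cos_two_mul, Real.sin_sq]
  ring_nf
  rw [Real.sin_sq]
  ring

theorem Tmat_rhoMM (θ p : ℝ) : Tmat (rhoMM θ p) =
    diagonal ![p * Real.sin (2 * θ), -(p * Real.sin (2 * θ)),
      p + (1 - p) * Real.cos (2 * θ) ^ 2] := by
  ext i j
  fin_cases i <;> fin_cases j <;>
    simp [Tmat, rhoMM, pauli, rhoA, phiProj, phiVec, Matrix.trace, Matrix.mul_apply,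
      Fintype.sum_prod_type, Fin.sum_univ_two, vecMulVec_apply, kroneckerMap_apply,
      -Complex.ofReal_cos, -Complex.ofReal_sin, ← Complex.ofReal_pow, ← Complex.ofReal_mul]
  · rw [Real.sin_two_mul]; ring
  · rw [Real.sin_two_mul]; ring
  · rw [Real.cos_two_mul, Real.sin_sq]
    ring_nf
    rw [Real.sin_sq]
    ring

theorem norm3_third_axis (x : ℝ) : norm3 ![0, 0, x] = |x| := by
  simp [norm3, Fin.sum_univ_three, Real.sqrt_sq_eq_abs]

/-- The centre formula when both Bloch vectors lie along the third axis and the correlation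
matrix is diagonal. -/
theorem centre_third_axis {c p : ℝ} (u v : ℝ) (hc : 1 - c ^ 2 ≠ 0) :
    (1 - norm3 ![0, 0, c] ^ 2)⁻¹ • (![0, 0, c] -
      diagonal ![u, v, p + (1 - p) * c ^ 2] *ᵥ ![0, 0, c]) = ![0, 0, (1 - p) * c] := by
  rw [norm3_third_axis, sq_abs]
  funext i
  simp only [Pi.smul_apply, Pi.sub_apply, mulVec_diagonal]
  fin_cases i <;> simp
  field_simp
  ring

/-- both QSE centre magnitudes of ρ_MM(θ,p) equal (1−p)cos(2θ). -/
theorem stmt_14 (θ p : ℝ) (hθ₀ : 0 < θ) (hθ₁ : θ ≤ Real.pi / 4)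
    (hp₀ : 0 ≤ p) (hp₁ : p ≤ 1) :
    norm3 (cA (rhoMM θ p)) = (1 - p) * Real.cos (2 * θ) ∧
    norm3 (cB (rhoMM θ p)) = (1 - p) * Real.cos (2 * θ) := by
  have hc₀ : 0 ≤ Real.cos (2 * θ) :=
    Real.cos_nonneg_of_neg_pi_div_two_le_of_le (by linarith) (by linarith)
  have hs : 0 < Real.sin (2 * θ) :=
    Real.sin_pos_of_pos_of_lt_pi (by linarith) (by linarith [Real.pi_pos])
  have hc : 1 - Real.cos (2 * θ) ^ 2 ≠ 0 := by
    rw [← Real.sin_sq]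
    positivity
  have hn : 0 ≤ (1 - p) * Real.cos (2 * θ) := mul_nonneg (by linarith) hc₀
  constructor
  · rw [cA, aVec_rhoMM, bVec_rhoMM, Tmat_rhoMM, centre_third_axis _ _ hc, norm3_third_axis,
      abs_of_nonneg hn]
  · rw [cB, aVec_rhoMM, bVec_rhoMM, Tmat_rhoMM, diagonal_transpose, centre_third_axis _ _ hc,
      norm3_third_axis, abs_of_nonneg hn]

end
end

section
/- Let p ∈ (0,1] and let ρ_QD(p) = p|Ψ⁻⟩⟨Ψ⁻| + (1−p)|00⟩⟨00| be the quasi-distillable state. Then both quantum steering ellipsoid centres satisfy ‖c_A(ρ_QD(p))‖ = ‖c_B(ρ_QD(p))‖ = 2(1−p)/(2−p). In particular, for 0 < p < 2/3 both centre magnitudes exceed 1/2. -/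
open Matrix Kronecker Complex
open scoped ComplexOrder

noncomputable section

/-- The entries of the singlet projector. -/
lemma singletProj_apply (i j : Fin 2 × Fin 2) :
    singletProj i j =
      if i.1 ≠ i.2 ∧ j.1 ≠ j.2 then (if i = j then 1 / 2 else -(1 / 2)) else 0 := by
  have h : ((Real.sqrt 2 : ℂ))⁻¹ * ((Real.sqrt 2 : ℂ))⁻¹ = 1 / 2 := by
    rw [← mul_inv, ← Complex.ofReal_mul, Real.mul_self_sqrt zero_le_two]
    norm_num
  rcases i with ⟨i₁, i₂⟩
  rcases j with ⟨j₁, j₂⟩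
  fin_cases i₁ <;> fin_cases i₂ <;> fin_cases j₁ <;> fin_cases j₂ <;>
    simp [singletProj, singletVec, vecMulVec_apply] <;>
    simpa using h

/-- Alice's Bloch vector of the quasi-distillable state. -/
lemma aVec_rhoQD (p : ℝ) : aVec (rhoQD p) = ![0, 0, 1 - p] := by
  ext i
  fin_cases i <;>
    simp [aVec, pauli, rhoQD, zeroVec, singletProj_apply, Matrix.trace, Matrix.mul_apply,
      Fintype.sum_prod_type, vecMulVec_apply, Matrix.one_apply]

/-- Bob's Bloch vector of the quasi-distillable state. -/
lemma bVec_rhoQD (p : ℝ) : bVec (rhoQD p) = ![0, 0, 1 - p] := by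
  ext i
  fin_cases i <;>
    simp [bVec, pauli, rhoQD, zeroVec, singletProj_apply, Matrix.trace, Matrix.mul_apply,
      Fintype.sum_prod_type, vecMulVec_apply, Matrix.one_apply]

/-- The correlation matrix of the quasi-distillable state. -/
lemma Tmat_rhoQD (p : ℝ) : Tmat (rhoQD p) = diagonal ![-p, -p, 1 - 2 * p] := by
  ext i j
  fin_cases i <;> fin_cases j <;>
    simp [Tmat, pauli, rhoQD, zeroVec, singletProj_apply, Matrix.trace, Matrix.mul_apply,
      Fintype.sum_prod_type, vecMulVec_apply, Matrix.diagonal] <;> ring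

/-- Both steering ellipsoids of the quasi-distillable state have the same centre. -/
lemma cB_rhoQD (p : ℝ) : cB (rhoQD p) = cA (rhoQD p) := by
  simp [cA, cB, aVec_rhoQD, bVec_rhoQD, Tmat_rhoQD]

/-- The steering ellipsoid centre of the quasi-distillable state lies on the third axis. -/
lemma cA_rhoQD {p : ℝ} (hp₀ : p ≠ 0) (hp₂ : p ≠ 2) :
    cA (rhoQD p) = ![0, 0, 2 * (1 - p) / (2 - p)] := by
  have h₂ : 2 - p ≠ 0 := sub_ne_zero.mpr hp₂.symm
  have hn : 1 - norm3 ![0, 0, 1 - p] ^ 2 = p * (2 - p) := by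
    rw [norm3, Real.sq_sqrt (Finset.sum_nonneg fun i _ => sq_nonneg _)]
    simp [Fin.sum_univ_three]
    ring
  have hT : diagonal ![-p, -p, 1 - 2 * p] *ᵥ ![0, 0, 1 - p] =
      ![0, 0, (1 - 2 * p) * (1 - p)] := by
    ext i
    rw [mulVec_diagonal]
    fin_cases i <;> simp
  rw [cA, aVec_rhoQD, bVec_rhoQD, Tmat_rhoQD, hn, hT]
  ext i
  fin_cases i
  · simp
  · simp
  · simp
    field_simp
    ring

/-- The norm of the steering ellipsoid centre of the quasi-distillable state. -/
lemma norm3_cA_rhoQD {p : ℝ} (hp₀ : 0 < p) (hp₁ : p ≤ 1) :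
    norm3 (cA (rhoQD p)) = 2 * (1 - p) / (2 - p) := by
  have h : 0 ≤ 2 * (1 - p) / (2 - p) := div_nonneg (by linarith) (by linarith)
  rw [cA_rhoQD hp₀.ne' (by linarith), norm3]
  simpa [Fin.sum_univ_three] using Real.sqrt_sq h

/-- both QSE centre magnitudes of ρ_QD(p) equal 2(1−p)/(2−p), which
exceeds 1/2 for 0 < p < 2/3. -/
theorem stmt_15 (p : ℝ) (hp₀ : 0 < p) (hp₁ : p ≤ 1) :
    norm3 (cA (rhoQD p)) = 2 * (1 - p) / (2 - p) ∧
    norm3 (cB (rhoQD p)) = 2 * (1 - p) / (2 - p) ∧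
    (p < 2 / 3 → 1 / 2 < 2 * (1 - p) / (2 - p)) := by
  refine ⟨norm3_cA_rhoQD hp₀ hp₁, ?_, fun hp => ?_⟩
  · rw [cB_rhoQD, norm3_cA_rhoQD hp₀ hp₁]
  · rw [div_lt_div_iff₀ two_pos (by linarith)]
    linarith

end
end

section
/- (Maximal hidden CHSH-inequality violation of the quasi-distillable states.) Let p ∈ (0,1] and ρ_QD(p) = p|Ψ⁻⟩⟨Ψ⁻| + (1−p)|00⟩⟨00|. Then for every ε > 0 there exist invertible 2×2 complex matrices f_A, f_B and unit vectors α¹,α²,β¹,β² ∈ ℝ³ such that the filtered state ρ' = (f_A⊗f_B)ρ_QD(p)(f_A⊗f_B)†/tr[(f_A†f_A⊗f_B†f_B)ρ_QD(p)] satisfies ½(⟨A¹B¹⟩+⟨A¹B²⟩+⟨A²B¹⟩−⟨A²B²⟩) > √2 − ε, where A^i = Σ_k α^i_k σ_k, B^j = Σ_k β^j_k σ_k and ⟨AB⟩ = tr((A⊗B)ρ'). Hence the supremum over local filters of the maximal CHSH value of the filtered state equals √2, the maximum allowed by quantum theory. -/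
open Matrix Kronecker Complex
open scoped ComplexOrder

noncomputable section

/-- The unnormalized expectation of a product operator in the quasi-distillable state. -/
lemma trace_kronecker_mul_rhoQD (p : ℝ) (A B : Mat2) :
    ((A ⊗ₖ B) * rhoQD p).trace =
      p / 2 * (A 0 0 * B 1 1 + A 1 1 * B 0 0 - A 0 1 * B 1 0 - A 1 0 * B 0 1)
        + (1 - p) * (A 0 0 * B 0 0) := by
  have hs : ((Real.sqrt 2 : ℝ) : ℂ)⁻¹ * ((Real.sqrt 2 : ℝ) : ℂ)⁻¹ = 1 / 2 := by
    rw [← mul_inv, ← Complex.ofReal_mul, Real.mul_self_sqrt (by norm_num)]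
    norm_num
  simp [Matrix.trace, Matrix.mul_apply, Fintype.sum_prod_type, rhoQD, singletProj, singletVec,
    zeroVec, vecMulVec_apply, Complex.conj_ofReal]
  linear_combination
    p * (A 0 0 * B 1 1 + A 1 1 * B 0 0 - A 0 1 * B 1 0 - A 1 0 * B 0 1) * hs

/-- A product expectation in a filtered state, with the filters moved onto the observables. -/
lemma expVal_filterAB (ρ : Mat4) (f g A B : Mat2) :
    expVal (filterAB ρ f g) A B =
      (((((fᴴ * f) ⊗ₖ (gᴴ * g)) * ρ).trace)⁻¹ *
        (((fᴴ * A * f) ⊗ₖ (gᴴ * B * g)) * ρ).trace).re := by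
  have h : ((A ⊗ₖ B) * ((f ⊗ₖ g) * ρ * (f ⊗ₖ g)ᴴ)).trace =
      (((fᴴ * A * f) ⊗ₖ (gᴴ * B * g)) * ρ).trace := by
    rw [mul_kronecker_mul, mul_kronecker_mul, conjTranspose_kronecker, ← Matrix.mul_assoc,
      Matrix.trace_mul_comm]
    simp only [Matrix.mul_assoc]
  rw [expVal, filterAB, Matrix.mul_smul, Matrix.trace_smul, h, smul_eq_mul]

/-- Equatorial correlations of the quasi-distillable state filtered by `diag(δ, 1)` on
both sides. -/
lemma expVal_filterAB_rhoQD (p δ : ℝ) (hδ : δ ≠ 0) (hD : p + (1 - p) * δ ^ 2 ≠ 0)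
    (a b c d : ℝ) :
    expVal (filterAB (rhoQD p) !![(δ : ℂ), 0; 0, 1] !![(δ : ℂ), 0; 0, 1])
      (obs ![a, b, 0]) (obs ![c, d, 0]) =
      -(a * c + b * d) * (p / (p + (1 - p) * δ ^ 2)) := by
  rw [expVal_filterAB, trace_kronecker_mul_rhoQD, trace_kronecker_mul_rhoQD]
  have hN : (p / 2 * ((δ : ℂ) * δ + δ * δ) + (1 - p) * (δ * δ * (δ * δ)) : ℂ) =
      ((δ ^ 2 * (p + (1 - p) * δ ^ 2) : ℝ) : ℂ) := by
    push_cast; ring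
  simp [obs, pauli, Fin.sum_univ_three, Matrix.mul_apply, vecHead, vecTail]
  have hN' : p / 2 * (δ * δ + δ * δ) + (1 - p) * (δ * δ * (δ * δ)) =
      δ ^ 2 * (p + (1 - p) * δ ^ 2) := by ring
  rw [hN, normSq_ofReal, hN']
  generalize p + (1 - p) * δ ^ 2 = D at hD
  field_simp
  ring

/-- maximal hidden CHSH-inequality violation of the quasi-distillable
states: local filters can bring the CHSH functional arbitrarily close to √2. -/
theorem stmt_17 (p : ℝ) (hp₀ : 0 < p) (hp₁ : p ≤ 1) (ε : ℝ) (hε : 0 < ε) :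
    ∃ (fA fB : Mat2) (α1 α2 β1 β2 : Fin 3 → ℝ), IsUnit fA ∧ IsUnit fB ∧
      norm3 α1 = 1 ∧ norm3 α2 = 1 ∧ norm3 β1 = 1 ∧ norm3 β2 = 1 ∧
      Real.sqrt 2 - ε < chshVal (filterAB (rhoQD p) fA fB) α1 α2 β1 β2 := by
  have hs : Real.sqrt 2 ^ 2 = 2 := Real.sq_sqrt (by norm_num)
  have hs0 : 0 < Real.sqrt 2 := by positivity
  have hs2 : Real.sqrt 2 < 2 := by nlinarith
  set δ := Real.sqrt (p * ε / 2)
  have hδ : 0 < δ := Real.sqrt_pos.mpr (by positivity)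
  have hδ2 : δ ^ 2 = p * ε / 2 := Real.sq_sqrt (by positivity)
  have hunit : IsUnit (!![(δ : ℂ), 0; 0, 1] : Mat2) := by
    rw [Matrix.isUnit_iff_isUnit_det]
    simp [Matrix.det_fin_two, hδ.ne']
  have hr : (1 / Real.sqrt 2) ^ 2 = 1 / 2 := by rw [div_pow, hs]; norm_num
  refine ⟨!![(δ : ℂ), 0; 0, 1], !![(δ : ℂ), 0; 0, 1], ![1, 0, 0], ![0, 1, 0],
    ![-(1 / Real.sqrt 2), -(1 / Real.sqrt 2), 0], ![-(1 / Real.sqrt 2), 1 / Real.sqrt 2, 0],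
    hunit, hunit, ?_, ?_, ?_, ?_, ?_⟩
  · simp [norm3, Fin.sum_univ_three]
  · simp [norm3, Fin.sum_univ_three]
  · simp only [norm3, Fin.sum_univ_three, cons_val, neg_sq, hr]; norm_num
  · simp only [norm3, Fin.sum_univ_three, cons_val, neg_sq, hr]; norm_num
  · have hD : 0 < p + (1 - p) * δ ^ 2 := by nlinarith [sq_nonneg δ]
    simp only [chshVal, expVal_filterAB_rhoQD p δ hδ.ne' hD.ne']
    have hval : ∀ q : ℝ, Real.sqrt 2 * q = 2 * (1 / Real.sqrt 2) * q := by
      intro q; field_simp; rw [hs]; ring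
    have hmain : Real.sqrt 2 - ε < Real.sqrt 2 * (p / (p + (1 - p) * δ ^ 2)) := by
      rw [← mul_div_assoc, lt_div_iff₀ hD, hδ2]
      have h1 : 0 < p * ε := by positivity
      have h2 : 0 ≤ (1 - p) * (p * ε) := mul_nonneg (by linarith) h1.le
      nlinarith [mul_nonneg h2 hε.le, mul_nonneg h2 hs0.le, mul_pos h1 hp₀,
        mul_le_mul_of_nonneg_left hs2.le h2]
    rw [hval] at hmain
    linarith

end
end

section
/- (Maximal hidden F₃-inequality violation of the quasi-distillable states.) Let p ∈ (0,1] and ρ_QD(p) = p|Ψ⁻⟩⟨Ψ⁻| + (1−p)|00⟩⟨00|. Then for every ε > 0 there exist invertible 2×2 complex matrices f_A, f_B and unit vectors α¹,α²,α³ ∈ ℝ³ such that the filtered state ρ' = (f_A⊗f_B)ρ_QD(p)(f_A⊗f_B)†/tr[(f_A†f_A⊗f_B†f_B)ρ_QD(p)] satisfies (1/√3)Σ_{i=1}^{3} tr((A^i⊗σ_i)ρ') > √3 − ε, where A^i = Σ_k α^i_k σ_k. Hence the supremum over local filters of the maximal F₃ value of the filtered state equals √3, the maximum allowed by quantum theory.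 -/
open Matrix Kronecker Complex
open scoped ComplexOrder

noncomputable section

lemma inv_sqrt_two_mul_self : ((Real.sqrt 2 : ℂ))⁻¹ * ((Real.sqrt 2 : ℂ))⁻¹ = 1 / 2 := by
  rw [← mul_inv, ← Complex.ofReal_mul, Real.mul_self_sqrt (by norm_num)]; norm_num

/-- The trace normalising the filtered state, for equal diagonal filters `diag(s, 1)`. -/
lemma trace_diagFilter_rhoQD (p s : ℝ) :
    (((!![(s : ℂ), 0; 0, 1]ᴴ * !![(s : ℂ), 0; 0, 1]) ⊗ₖ
      (!![(s : ℂ), 0; 0, 1]ᴴ * !![(s : ℂ), 0; 0, 1])) * rhoQD p).trace =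
      ((p * s ^ 2 + (1 - p) * s ^ 4 : ℝ) : ℂ) := by
  simp [Matrix.trace, Matrix.mul_apply, Fintype.sum_prod_type, Fin.sum_univ_two, rhoQD,
    singletProj, singletVec, zeroVec, vecMulVec_apply, kroneckerMap_apply, inv_sqrt_two_mul_self]
  ring

/-- The F₃ value of the filtered state when Alice measures along the directions `-eᵢ`. -/
lemma f3Val_diagFilter_rhoQD (p s : ℝ) :
    f3Val (filterAB (rhoQD p) !![(s : ℂ), 0; 0, 1] !![(s : ℂ), 0; 0, 1])
      (fun i k => if k = i then -1 else 0) =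
      (3 * p * s ^ 2 - (1 - p) * s ^ 4) / (p * s ^ 2 + (1 - p) * s ^ 4) / Real.sqrt 3 := by
  have key : ∑ i, ((obs (fun k => if k = i then -1 else 0) ⊗ₖ pauli i) *
      ((!![(s : ℂ), 0; 0, 1] ⊗ₖ !![(s : ℂ), 0; 0, 1]) * rhoQD p *
        (!![(s : ℂ), 0; 0, 1] ⊗ₖ !![(s : ℂ), 0; 0, 1])ᴴ)).trace =
      ((3 * p * s ^ 2 - (1 - p) * s ^ 4 : ℝ) : ℂ) := by
    simp [Matrix.trace, Matrix.mul_apply, Fintype.sum_prod_type, Fin.sum_univ_two,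
      Fin.sum_univ_three, rhoQD, obs, pauli, singletProj, singletVec, zeroVec, vecMulVec_apply,
      kroneckerMap_apply, inv_sqrt_two_mul_self]
    ring
  rw [f3Val]
  congr 1
  simp only [expVal, filterAB, trace_diagFilter_rhoQD, Matrix.mul_smul, Matrix.trace_smul]
  rw [← Complex.re_sum, ← Finset.smul_sum, key, smul_eq_mul, ← Complex.ofReal_inv,
    ← Complex.ofReal_mul, Complex.ofReal_re, inv_mul_eq_div]

/-- maximal hidden F₃-inequality violation of the quasi-distillable
states: local filters can bring the F₃ functional arbitrarily close to √3. -/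
theorem stmt_18 (p : ℝ) (hp₀ : 0 < p) (hp₁ : p ≤ 1) (ε : ℝ) (hε : 0 < ε) :
    ∃ (fA fB : Mat2) (α : Fin 3 → Fin 3 → ℝ), IsUnit fA ∧ IsUnit fB ∧
      (∀ i, norm3 (α i) = 1) ∧
      Real.sqrt 3 - ε < f3Val (filterAB (rhoQD p) fA fB) α := by
  obtain ⟨s, hs, hs2⟩ : ∃ s : ℝ, 0 < s ∧ s ^ 2 = p * ε / 3 :=
    ⟨Real.sqrt (p * ε / 3), by positivity, Real.sq_sqrt (by positivity)⟩
  have hu : IsUnit (!![(s : ℂ), 0; 0, 1] : Mat2) := by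
    rw [Matrix.isUnit_iff_isUnit_det, Matrix.det_fin_two_of, isUnit_iff_ne_zero]
    simpa using hs.ne'
  refine ⟨_, _, fun i k => if k = i then -1 else 0, hu, hu, fun i => ?_, ?_⟩
  · fin_cases i <;> simp [norm3]
  · have h3 : 0 < Real.sqrt 3 := by positivity
    have h33 : Real.sqrt 3 ^ 2 = 3 := Real.sq_sqrt (by norm_num)
    have hlt : 4 / 3 < Real.sqrt 3 := by
      rw [Real.lt_sqrt (by norm_num)]; norm_num
    have hq : 0 ≤ 1 - p := by linarith
    have hD : 0 < p * s ^ 2 + (1 - p) * s ^ 4 := by positivity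
    rw [f3Val_diagFilter_rhoQD, div_div, lt_div_iff₀ (by positivity)]
    have hs4 : s ^ 4 = s ^ 2 * (p * ε / 3) := by rw [← hs2]; ring
    have hA : (1 - p) * s ^ 4 ≤ s ^ 2 * (p * ε / 3) := by
      rw [← hs4]; nlinarith [pow_pos hs 4]
    have hE : 0 < ε * (p * s ^ 2) := by positivity
    have hE' : 0 ≤ ε * ((1 - p) * s ^ 4) := by positivity
    have e : (Real.sqrt 3 - ε) * ((p * s ^ 2 + (1 - p) * s ^ 4) * Real.sqrt 3) =
        (3 - ε * Real.sqrt 3) * (p * s ^ 2 + (1 - p) * s ^ 4) := by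
      linear_combination (p * s ^ 2 + (1 - p) * s ^ 4) * h33
    rw [e]
    nlinarith [mul_lt_mul_of_pos_right hlt hE, mul_nonneg h3.le hE']

end
end
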